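/- Let B := ℤ_(p)[v_1, v_2, v_3, …] be the polynomial ring over ℤ_(p) in countably many variables, let B_n := ℤ_(p)[v_1, …, v_n], and let q: B → B_n be the ℤ_(p)-algebra homomorphism with q(v_i) = v_i for 1 ≤ i ≤ n and q(v_i) = 0 for i > n. Let N be a B_n-module, regarded as a B-module via q. Then for every s ≥ 0 there is an isomorphism of 𝔽_p-vector spaces Tor_s^B(𝔽_p, N) ≅ ⊕_{j=0}^{s} Tor_{s−j}^{B_n}(𝔽_p, N) ⊗_{𝔽_p} Λ^j(V), where V is an 𝔽_p-vector space with countable basis indexed by {v_{n+1}, v_{n+2}, …} and Λ^j denotes the j-th exterior power over 𝔽_p. -/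

import Mathlib

open CategoryTheory

set_option maxHeartbeats 1000000
set_option synthInstance.maxHeartbeats 1000000

noncomputable section

variable (p n : ℕ) [Fact p.Prime] [hP : (Ideal.span {(p : ℤ)}).IsPrime]

/-- `ℤ_(p)`, the localization of `ℤ` at the prime ideal `(p)`. -/
abbrev Zp : Type := Localization.AtPrime (Ideal.span {(p : ℤ)})

/-- `B := ℤ_(p)[v_1, v_2, …]`, the polynomial ring over `ℤ_(p)` in countably many variables
(the variable `X k` plays the role of `v_{k+1}`). -/
abbrev B : Type := MvPolynomial ℕ (Zp p)

/-- `B_n := ℤ_(p)[v_1, …, v_n]` (the variable `X i`, `i : Fin n`, plays the role of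
`v_{i+1}`). -/
abbrev Bn : Type := MvPolynomial (Fin n) (Zp p)

/-- The `ℤ_(p)`-algebra map `q : B → B_n` with `q(v_i) = v_i` for `i ≤ n` and `q(v_i) = 0`
for `i > n`. -/
def qB : B p →ₐ[Zp p] Bn p n :=
  MvPolynomial.aeval (fun k => if h : k < n then MvPolynomial.X (⟨k, h⟩ : Fin n) else 0)

/-- The maximal ideal `(p, v_1, v_2, …) ⊆ B`. -/
def mB : Ideal (B p) := Ideal.span ({(p : B p)} ∪ Set.range MvPolynomial.X)

/-- The maximal ideal `(p, v_1, …, v_n) ⊆ B_n`. -/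
def mBn : Ideal (Bn p n) := Ideal.span ({(p : Bn p n)} ∪ Set.range MvPolynomial.X)

/-- `𝔽_p` viewed as the `B`-module `B/(p, v_1, v_2, …)`. -/
def FpB : ModuleCat (B p) := ModuleCat.of (B p) (B p ⧸ mB p)

/-- `𝔽_p` viewed as the `B_n`-module `B_n/(p, v_1, …, v_n)`. -/
def FpBn : ModuleCat (Bn p n) := ModuleCat.of (Bn p n) (Bn p n ⧸ mBn p n)

/-- `Tor_k^{B_n}(𝔽_p, N)`. -/
def TorBn (k : ℕ) (N : ModuleCat (Bn p n)) : ModuleCat (Bn p n) :=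
  ((Tor (ModuleCat (Bn p n)) k).obj (FpBn p n)).obj N

end

section LeftDerived

open Limits

universe v' u'

variable {C : Type u'} [Category.{v'} C] [Abelian C]

/-- A connective complex which is exact in positive degrees breaks up into short exact
sequences relating its successive opcycles. -/
lemma shortExact_opcycles (K : ChainComplex C ℕ) (i : ℕ) (hK : K.ExactAt (i + 1)) :
    (ShortComplex.mk (K.fromOpcycles (i + 1) i) (K.pOpcycles i)
      (by rw [← cancel_epi (K.pOpcycles (i + 1))]; simp)).ShortExact where
  exact := by
    have h1 : (ShortComplex.mk (K.d (i + 1) i) (K.pOpcycles i) (by simp)).Exact :=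
      ShortComplex.exact_of_g_is_cokernel _ (K.opcyclesIsCokernel (i + 1) i (by simp))
    let φ : ShortComplex.mk (K.d (i + 1) i) (K.pOpcycles i) (by simp) ⟶
      ShortComplex.mk (K.fromOpcycles (i + 1) i) (K.pOpcycles i)
        (by rw [← cancel_epi (K.pOpcycles (i + 1))]; simp) :=
      { τ₁ := K.pOpcycles (i + 1)
        τ₂ := 𝟙 _
        τ₃ := 𝟙 _ }
    have : Epi φ.τ₁ := by dsimp [φ]; infer_instance
    have : IsIso φ.τ₂ := by dsimp [φ]; infer_instance
    have : Mono φ.τ₃ := by dsimp [φ]; infer_instance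
    exact (ShortComplex.exact_iff_of_epi_of_isIso_of_mono φ).1 h1
  mono_f := by
    have h := K.homologyIsKernel (i + 1) i (by simp)
    have hz : IsZero (K.homology (i + 1)) := hK.isZero_homology
    exact Preadditive.mono_of_isZero_kernel' _ h hz
  epi_g := by dsimp; infer_instance

variable {D : Type*} [Category* D] [Abelian D]

/-- A right exact functor commutes with opcycles. -/
noncomputable def mapOpcyclesIso (G : C ⥤ D) [G.Additive] [PreservesFiniteColimits G]
    (K : ChainComplex C ℕ) (i : ℕ) :
    G.obj (K.opcycles i) ≅ ((G.mapHomologicalComplex _).obj K).opcycles i :=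
  (CokernelCofork.mapIsColimit _ (K.opcyclesIsCokernel (i + 1) i (by simp))
    G).coconePointUniqueUpToIso
    (((G.mapHomologicalComplex _).obj K).opcyclesIsCokernel (i + 1) i (by simp))

lemma mapOpcyclesIso_fromOpcycles (G : C ⥤ D) [G.Additive] [PreservesFiniteColimits G]
    (K : ChainComplex C ℕ) (i j : ℕ) :
    (mapOpcyclesIso G K i).hom ≫ ((G.mapHomologicalComplex _).obj K).fromOpcycles i j =
      G.map (K.fromOpcycles i j) := by
  have h : G.map (K.pOpcycles i) ≫ (mapOpcyclesIso G K i).hom =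
      ((G.mapHomologicalComplex _).obj K).pOpcycles i :=
    (CokernelCofork.mapIsColimit _ (K.opcyclesIsCokernel (i + 1) i (by simp))
      G).comp_coconePointUniqueUpToIso_hom _ WalkingParallelPair.one
  refine (cancel_epi (G.map (K.pOpcycles i))).1 ?_
  refine (Category.assoc _ _ _).symm.trans ?_
  refine (congrArg (· ≫ ((G.mapHomologicalComplex _).obj K).fromOpcycles i j) h).trans ?_
  refine (((G.mapHomologicalComplex _).obj K).p_fromOpcycles i j).trans ?_
  exact (congrArg G.map (K.p_fromOpcycles i j).symm).trans (G.map_comp _ _)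

variable [HasProjectiveResolutions C] (G : C ⥤ D) [G.Additive] [PreservesFiniteColimits G]
  (T : C ⥤ ChainComplex D ℕ) [T.PreservesZeroMorphisms]

/-- The opcycles in degree zero of a projective resolution. -/
noncomputable def opcyclesZeroIso {N : C} (P : ProjectiveResolution N) :
    P.complex.opcycles 0 ≅ N :=
  (P.complex.opcyclesIsCokernel 1 0 (by simp)).coconePointUniqueUpToIso
    P.isColimitCokernelCofork

/-- Left derived functors can be computed from any functor to complexes which is exact, sends
projective objects to complexes which are acyclic in positive degrees, and whose homology in
degree zero is the functor to be derived. -/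
theorem nonempty_leftDerived_iso_homology
    (hT : ∀ S : ShortComplex C, S.ShortExact → (S.map T).ShortExact)
    (hP : ∀ (P : C) [Projective P] (k : ℕ), IsZero ((T.obj P).homology (k + 1)))
    (e : T ⋙ HomologicalComplex.homologyFunctor D _ 0 ≅ G) (N : C) (s : ℕ) :
    Nonempty ((G.leftDerived s).obj N ≅ (T.obj N).homology s) := by
  obtain _ | s := s
  · exact ⟨(Functor.leftDerivedZeroIsoSelf G).app N ≪≫ (e.app N).symm⟩
  let P := projectiveResolution N
  let K := P.complex
  have hS (i : ℕ) := hT _ (shortExact_opcycles K i (P.complex_exactAt_succ i))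
  have shift (i k : ℕ) :
      Nonempty ((T.obj (K.opcycles i)).homology (k + 2) ≅
        (T.obj (K.opcycles (i + 1))).homology (k + 1)) :=
    ⟨(hS i).δIso (k + 2) (k + 1) (by simp) (hP (K.X i) (k + 1)) (hP (K.X i) k)⟩
  have shifts (k : ℕ) : ∀ i, Nonempty ((T.obj (K.opcycles i)).homology (k + 1) ≅
        (T.obj (K.opcycles (i + k))).homology 1) := by
    induction k with
    | zero => exact fun i => ⟨Iso.refl _⟩
    | succ k ih =>
      intro i
      obtain ⟨a⟩ := shift i k
      obtain ⟨b⟩ := ih (i + 1)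
      have : i + 1 + k = i + (k + 1) := by omega
      exact ⟨a ≪≫ b ≪≫ eqToIso (by rw [this])⟩
  obtain ⟨a⟩ := shifts s 0
  rw [zero_add] at a
  have a0 : (T.obj N).homology (s + 1) ≅ (T.obj (K.opcycles 0)).homology (s + 1) :=
    (T ⋙ HomologicalComplex.homologyFunctor D _ (s + 1)).mapIso (opcyclesZeroIso P).symm
  have := (hS s).mono_δ 1 0 (by simp) (hP (K.X s) 0)
  have ex := (hS s).homology_exact₁ 1 0 (by simp)
  have isk := ex.fIsKernel
  have b := isk.conePointUniqueUpToIso (kernelIsKernel _)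
  have sq : (e.app (K.opcycles (s + 1))).hom ≫ G.map (K.fromOpcycles (s + 1) s) =
      HomologicalComplex.homologyMap (T.map (K.fromOpcycles (s + 1) s)) 0 ≫ (e.app (K.X s)).hom :=
    (e.hom.naturality _).symm
  have c := kernel.mapIso (HomologicalComplex.homologyMap (T.map (K.fromOpcycles (s + 1) s)) 0)
    (G.map (K.fromOpcycles (s + 1) s)) (e.app _) (e.app _) sq.symm
  have d := kernel.mapIso (G.map (K.fromOpcycles (s + 1) s))
    (((G.mapHomologicalComplex _).obj K).fromOpcycles (s + 1) s) (mapOpcyclesIso G K (s + 1))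
      (Iso.refl _) ((Category.comp_id _).trans (mapOpcyclesIso_fromOpcycles G K (s + 1) s).symm)
  have f := (((G.mapHomologicalComplex _).obj K).homologyIsKernel (s + 1) s
    (by simp)).conePointUniqueUpToIso (kernelIsKernel _)
  exact ⟨P.isoLeftDerivedObj G (s + 1) ≪≫ f ≪≫ d.symm ≪≫ c.symm ≪≫ b.symm ≪≫ a.symm ≪≫ a0.symm⟩

end LeftDerived

section Koszul

variable {ι : Type*} [LinearOrder ι] {R : Type*} [CommRing R]

/-- The sign with which `m` is contracted from, or wedged onto, the monomial indexed by `S`. -/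
def koszulSign (R : Type*) [CommRing R] (m : ι) (S : Finset ι) : R :=
  (-1) ^ (S.filter (· < m)).card

lemma koszulSign_mul_self (m : ι) (S : Finset ι) : koszulSign R m S * koszulSign R m S = 1 := by
  rw [koszulSign, ← mul_pow]; simp

lemma koszulSign_erase_self (m : ι) (S : Finset ι) :
    koszulSign R m (S.erase m) = koszulSign R m S := by
  unfold koszulSign
  congr 2
  ext l
  simp only [Finset.mem_filter, Finset.mem_erase]
  grind

lemma koszulSign_insert_self (m : ι) (S : Finset ι) :
    koszulSign R m (insert m S) = koszulSign R m S := by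
  unfold koszulSign
  congr 2
  ext l
  simp only [Finset.mem_filter, Finset.mem_insert]
  grind

lemma koszulSign_insert_mul {l m : ι} {S : Finset ι} (hl : l ∈ S) (hm : m ∉ S) :
    koszulSign R l (insert m S) * koszulSign R m S =
      -(koszulSign R l S * koszulSign R m (S.erase l)) := by
  unfold koszulSign
  have hlm : l ≠ m := fun h => hm (h ▸ hl)
  rcases lt_or_gt_of_ne hlm with h | h
  · have h1 : (insert m S).filter (· < l) = S.filter (· < l) := by
      ext a; simp only [Finset.mem_filter, Finset.mem_insert]; grind
    have h2 : S.filter (· < m) = insert l ((S.erase l).filter (· < m)) := by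
      ext a; simp only [Finset.mem_filter, Finset.mem_insert, Finset.mem_erase]; grind
    rw [h1, h2, Finset.card_insert_of_notMem (by simp)]
    ring
  · have h1 : (insert m S).filter (· < l) = insert m (S.filter (· < l)) := by
      ext a; simp only [Finset.mem_filter, Finset.mem_insert]; grind
    have h2 : S.filter (· < m) = (S.erase l).filter (· < m) := by
      ext a; simp only [Finset.mem_filter, Finset.mem_erase]; grind
    rw [h1, h2, Finset.card_insert_of_notMem (by simp [hm])]
    ring

variable (x : ι → R) (M : Type*) [AddCommGroup M] [Module R M]

/-- The Koszul differential on `M ⊗ Λ(ι)`, written in the basis of monomials. -/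
noncomputable def koszulD : (Finset ι →₀ M) →ₗ[R] (Finset ι →₀ M) :=
  Finsupp.lsum R fun S => ∑ m ∈ S, (koszulSign R m S * x m) • Finsupp.lsingle (S.erase m)

/-- Left multiplication by the generator `m` on `M ⊗ Λ(ι)`. -/
noncomputable def koszulWedge (R M : Type*) [CommRing R] [AddCommGroup M] [Module R M] (m : ι) :
    (Finset ι →₀ M) →ₗ[R] (Finset ι →₀ M) :=
  Finsupp.lsum R fun S => if m ∈ S then 0 else koszulSign R m S • Finsupp.lsingle (insert m S)

variable {M}

lemma koszulD_single (S : Finset ι) (a : M) :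
    koszulD x M (Finsupp.single S a) =
      ∑ m ∈ S, (koszulSign R m S * x m) • Finsupp.single (S.erase m) a := by
  simp [koszulD]

lemma koszulWedge_single_of_mem {m : ι} {S : Finset ι} (h : m ∈ S) (a : M) :
    koszulWedge R M m (Finsupp.single S a) = 0 := by
  simp [koszulWedge, h]

lemma koszulWedge_single_of_notMem {m : ι} {S : Finset ι} (h : m ∉ S) (a : M) :
    koszulWedge R M m (Finsupp.single S a) =
      koszulSign R m S • Finsupp.single (insert m S) a := by
  simp [koszulWedge, h]

lemma koszulD_wedge (m : ι) (z : Finset ι →₀ M) :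
    koszulD x M (koszulWedge R M m z) = x m • z - koszulWedge R M m (koszulD x M z) := by
  induction z using Finsupp.induction_linear with
  | zero => simp
  | add f g hf hg => simp only [map_add, smul_add, hf, hg]; abel
  | single S a =>
    rw [koszulD_single, map_sum]
    by_cases hm : m ∈ S
    · rw [koszulWedge_single_of_mem hm, Finset.sum_eq_single m]
      · rw [map_smul, koszulWedge_single_of_notMem (Finset.notMem_erase m S), smul_smul,
          koszulSign_erase_self, Finset.insert_erase hm, mul_right_comm, koszulSign_mul_self]
        simp
      · intro l _ hlm
        rw [map_smul, koszulWedge_single_of_mem (by simp [hm, hlm.symm]), smul_zero]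
      · exact fun h => absurd hm h
    · rw [koszulWedge_single_of_notMem hm, map_smul, koszulD_single, Finset.sum_insert hm,
        smul_add, smul_smul, koszulSign_insert_self, ← mul_assoc, koszulSign_mul_self, one_mul,
        Finset.erase_insert hm, sub_eq_add_neg, ← Finset.sum_neg_distrib, Finset.smul_sum]
      congr 1
      refine Finset.sum_congr rfl fun l hl => ?_
      have hlm : m ≠ l := fun h => hm (h ▸ hl)
      rw [map_smul, koszulWedge_single_of_notMem (by simp [hm]), smul_smul, smul_smul, ← neg_smul,
        Finset.erase_insert_of_ne hlm]
      congr 1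
      linear_combination x l * koszulSign_insert_mul (R := R) hl hm

lemma koszulD_koszulD (z : Finset ι →₀ M) : koszulD x M (koszulD x M z) = 0 := by
  induction z using Finsupp.induction_linear with
  | zero => simp
  | add f g hf hg => simp only [map_add, hf, hg, add_zero]
  | single S a =>
    induction S using Finset.induction_on with
    | empty => simp [koszulD_single]
    | insert m S hm ih =>
      have : Finsupp.single (insert m S) a =
          koszulSign R m S • koszulWedge R M m (Finsupp.single S a) := by
        rw [koszulWedge_single_of_notMem hm, smul_smul, koszulSign_mul_self, one_smul]
      rw [this, map_smul, map_smul, koszulD_wedge, map_sub, map_smul, koszulD_wedge, ih]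
      simp

/-- The elements of `M ⊗ Λ(ι)` which only involve generators in `A`. -/
def koszulSupp {ι : Type*} (R M : Type*) [CommRing R] [AddCommGroup M] [Module R M] (A : Finset ι) :
    Submodule R (Finset ι →₀ M) :=
  Finsupp.supported M R {S | S ⊆ A}

lemma single_mem_koszulSupp {ι : Type*} {A S : Finset ι} (h : S ⊆ A) (a : M) :
    Finsupp.single S a ∈ koszulSupp R M A :=
  Finsupp.single_mem_supported R a h

lemma koszulSupp_induction {ι : Type*} {A : Finset ι} {P : (Finset ι →₀ M) → Prop} (h0 : P 0)
    (hadd : ∀ f g, P f → P g → P (f + g)) (hs : ∀ S ⊆ A, ∀ a, P (Finsupp.single S a))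
    {z : Finset ι →₀ M} (hz : z ∈ koszulSupp R M A) : P z := by
  rw [← Finsupp.sum_single z]
  exact Finset.sum_induction _ P hadd h0 fun S hS => hs S (hz hS) _

lemma koszulD_mem_koszulSupp {A : Finset ι} {z : Finset ι →₀ M} (hz : z ∈ koszulSupp R M A) :
    koszulD x M z ∈ koszulSupp R M A := by
  refine koszulSupp_induction (P := fun z => koszulD x M z ∈ koszulSupp R M A) ?_ ?_ ?_ hz
  · simp
  · intro f g hf hg
    rw [map_add]
    exact add_mem hf hg
  · intro S hS a
    rw [koszulD_single]
    exact sum_mem fun m _ => Submodule.smul_mem _ _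
      (single_mem_koszulSupp ((Finset.erase_subset _ _).trans hS) _)

lemma koszulWedge_mem_koszulSupp {A : Finset ι} {m : ι} {z : Finset ι →₀ M}
    (hz : z ∈ koszulSupp R M A) : koszulWedge R M m z ∈ koszulSupp R M (insert m A) := by
  refine koszulSupp_induction
    (P := fun z => koszulWedge R M m z ∈ koszulSupp R M (insert m A)) ?_ ?_ ?_ hz
  · simp
  · intro f g hf hg
    rw [map_add]
    exact add_mem hf hg
  · intro S hS a
    by_cases hm : m ∈ S
    · rw [koszulWedge_single_of_mem hm]
      exact zero_mem _
    · rw [koszulWedge_single_of_notMem hm]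
      exact Submodule.smul_mem _ _ (single_mem_koszulSupp (Finset.insert_subset_insert _ hS) _)

lemma exists_eq_add_koszulWedge {A : Finset ι} {m : ι} {z : Finset ι →₀ M}
    (hz : z ∈ koszulSupp R M (insert m A)) :
    ∃ a ∈ koszulSupp R M A, ∃ b ∈ koszulSupp R M A, z = a + koszulWedge R M m b := by
  refine koszulSupp_induction (P := fun z => ∃ a ∈ koszulSupp R M A, ∃ b ∈ koszulSupp R M A,
    z = a + koszulWedge R M m b) ?_ ?_ ?_ hz
  · exact ⟨0, zero_mem _, 0, zero_mem _, by simp⟩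
  · rintro _ _ ⟨a, ha, b, hb, rfl⟩ ⟨a', ha', b', hb', rfl⟩
    exact ⟨a + a', add_mem ha ha', b + b', add_mem hb hb', by rw [map_add]; abel⟩
  · intro S hS a
    by_cases hm : m ∈ S
    · refine ⟨0, zero_mem _, koszulSign R m S • Finsupp.single (S.erase m) a,
        Submodule.smul_mem _ _ (single_mem_koszulSupp ?_ _), ?_⟩
      · intro l hl
        have := hS (Finset.mem_of_mem_erase hl)
        have := Finset.ne_of_mem_erase hl
        grind
      · rw [map_smul, koszulWedge_single_of_notMem (Finset.notMem_erase m S), smul_smul,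
          koszulSign_erase_self, Finset.insert_erase hm, koszulSign_mul_self]
        simp
    · refine ⟨Finsupp.single S a, single_mem_koszulSupp ?_ _, 0, zero_mem _, by simp⟩
      intro l hl
      have := hS hl
      grind

/-- If `a + m ∧ b = 0`, where `a` and `b` do not involve `m`, then `b = 0`. -/
lemma eq_zero_of_add_koszulWedge_eq_zero {A : Finset ι} {m : ι} (hm : m ∉ A)
    {a b : Finset ι →₀ M} (ha : a ∈ koszulSupp R M A) (hb : b ∈ koszulSupp R M A)
    (h : a + koszulWedge R M m b = 0) : b = 0 := by
  have contract (z) (hz : z ∈ koszulSupp R M A) : koszulD (Pi.single m (1 : R)) M z = 0 := by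
    refine koszulSupp_induction
      (P := fun z => koszulD (Pi.single m (1 : R)) M z = 0) ?_ ?_ ?_ hz
    · simp
    · intro f g hf hg
      rw [map_add, hf, hg, add_zero]
    · intro S hS a
      rw [koszulD_single]
      refine Finset.sum_eq_zero fun l hl => ?_
      have : l ≠ m := fun h => hm (h ▸ hS hl)
      simp [this]
  have := congrArg (koszulD (Pi.single m (1 : R)) M) h
  rw [map_add, koszulD_wedge, contract a ha, contract b hb] at this
  simpa using this

lemma koszulD_apply_empty_mem {I : Ideal R} {c : Finset ι →₀ M}
    (hc : ∀ S ∈ c.support, ∀ m ∈ S, x m ∈ I) :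
    koszulD x M c ∅ ∈ I • (⊤ : Submodule R M) := by
  rw [← Finsupp.sum_single c, Finsupp.sum, map_sum, Finsupp.finsetSum_apply]
  refine sum_mem fun S hS => ?_
  rw [koszulD_single, Finsupp.finsetSum_apply]
  refine sum_mem fun l hl => ?_
  rw [Finsupp.smul_apply, mul_smul]
  exact Submodule.smul_mem _ _ (Submodule.smul_mem_smul (hc S hS l hl) trivial)

lemma exists_koszulD_eq_single (A : Set ι) {b : M}
    (hb : b ∈ Ideal.span (x '' A) • (⊤ : Submodule R M)) :
    ∃ c ∈ Finsupp.supported M R ((fun l => {l}) '' A : Set (Finset ι)),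
      koszulD x M c = Finsupp.single ∅ b := by
  set W := (Finsupp.supported M R ((fun l => {l}) '' A : Set (Finset ι))).map (koszulD x M)
  suffices h : Ideal.span (x '' A) • (⊤ : Submodule R M) ≤ W.comap (Finsupp.lsingle ∅) from h hb
  refine Submodule.smul_le.2 fun r hr a _ => ?_
  suffices h : Ideal.span (x '' A) ≤ (W.comap (Finsupp.lsingle ∅)).comap
      (LinearMap.toSpanSingleton R M a) from h hr
  refine Ideal.span_le.2 ?_
  rintro _ ⟨l, hl, rfl⟩
  refine ⟨Finsupp.single {l} a, Finsupp.single_mem_supported R a ⟨l, hl, rfl⟩, ?_⟩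
  rw [koszulD_single]
  simp [koszulSign, Finset.filter_singleton]

/-- If each `x m` is regular modulo finitely many of the `x l` with `m < l`, then the Koszul
complex is exact away from degree zero. -/
lemma exists_eq_koszulD_add
    (hx : ∀ (A : Finset ι) (m : ι), (∀ l ∈ A, m < l) → ∀ a : M,
      x m • a ∈ Ideal.span (x '' A) • (⊤ : Submodule R M) →
        a ∈ Ideal.span (x '' A) • (⊤ : Submodule R M))
    (A : Finset ι) {z : Finset ι →₀ M} (hz : z ∈ koszulSupp R M A) (hD : koszulD x M z = 0) :
    ∃ c ∈ koszulSupp R M A, ∃ b : M, z = koszulD x M c + Finsupp.single ∅ b := by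
  induction A using Finset.induction_on_min generalizing z with
  | empty =>
    refine ⟨0, zero_mem _, z ∅, ?_⟩
    rw [map_zero, zero_add]
    refine Finsupp.ext fun S => ?_
    by_cases hS : S = ∅
    · simp [hS]
    · rw [Finsupp.single_eq_of_ne hS]
      by_contra h
      exact hS (Finset.subset_empty.1 (hz (Finsupp.mem_support_iff.2 h)))
  | insert m A hm ih =>
    have hmA : m ∉ A := fun h => lt_irrefl _ (hm m h)
    obtain ⟨a, ha, b, hb, rfl⟩ := exists_eq_add_koszulWedge hz
    have hD' : (koszulD x M a + x m • b) + koszulWedge R M m (-koszulD x M b) = 0 := by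
      rw [← hD, map_add, koszulD_wedge, map_neg]; abel
    have hDb : koszulD x M b = 0 := neg_eq_zero.1 (eq_zero_of_add_koszulWedge_eq_zero hmA
      (add_mem (koszulD_mem_koszulSupp x ha) (Submodule.smul_mem _ _ hb))
      (neg_mem (koszulD_mem_koszulSupp x hb)) hD')
    obtain ⟨c, hc, β, rfl⟩ := ih hb hDb
    rw [hDb, neg_zero, map_zero, add_zero, smul_add, ← map_smul, ← add_assoc, ← map_add] at hD'
    have hβ : x m • β ∈ Ideal.span (x '' A) • (⊤ : Submodule R M) := by
      have h1 := koszulD_apply_empty_mem x (I := Ideal.span (x '' A)) (c := -(a + x m • c))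
        fun S hS l hl => Ideal.subset_span ⟨l, neg_mem
          (add_mem ha (Submodule.smul_mem _ (x m) hc)) hS hl, rfl⟩
      rw [map_neg, neg_eq_of_add_eq_zero_right hD'] at h1
      simpa using h1
    obtain ⟨γ, hγ, hγβ⟩ := exists_koszulD_eq_single x A (hx A m hm β hβ)
    replace hγ : γ ∈ koszulSupp R M A := Finsupp.supported_mono (by
      rintro _ ⟨l, hl, rfl⟩
      simpa using hl) hγ
    rw [← hγβ, ← map_add] at hDb ⊢
    have hcγ := add_mem hc hγ
    have hmono : koszulSupp R M A ≤ koszulSupp R M (insert m A) :=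
      Finsupp.supported_mono fun S hS => hS.trans (Finset.subset_insert _ _)
    have key : a + koszulWedge R M m (koszulD x M (c + γ)) =
        (a + x m • (c + γ)) - koszulD x M (koszulWedge R M m (c + γ)) := by
      rw [koszulD_wedge]; abel
    obtain ⟨c', hc', β', h'⟩ := ih (add_mem ha (Submodule.smul_mem _ (x m) hcγ)) (by
      have := hD
      rw [hγβ.symm, ← map_add, key, map_sub, koszulD_koszulD, sub_zero] at this
      exact this)
    refine ⟨c' - koszulWedge R M m (c + γ), sub_mem (hmono hc')
      (koszulWedge_mem_koszulSupp hcγ), β', ?_⟩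
    rw [key, h', map_sub]
    abel

end Koszul

section KoszulComplex

universe u

variable {ι R : Type u} [CommRing R]

/-- The elements of degree `k` in `M ⊗ Λ(ι)`. -/
abbrev koszulDeg (ι R M : Type*) [CommRing R] [AddCommGroup M] [Module R M] (k : ℕ) :
    Submodule R (Finset ι →₀ M) :=
  Finsupp.supported M R {S : Finset ι | S.card = k}

section

variable {M : Type*} [AddCommGroup M] [Module R M]

/-- The projection of `M ⊗ Λ(ι)` onto its part of degree `k`. -/
noncomputable abbrev koszulProj (ι R M : Type*) [CommRing R] [AddCommGroup M] [Module R M]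
    (k : ℕ) : (Finset ι →₀ M) →ₗ[R] koszulDeg ι R M k :=
  Finsupp.restrictDom M R {S : Finset ι | S.card = k}

lemma koszulProj_apply (k : ℕ) (z : Finset ι →₀ M) (S : Finset ι) :
    (koszulProj ι R M k z : Finset ι →₀ M) S = if S.card = k then z S else 0 := by
  rw [Finsupp.restrictDom_apply, Finsupp.filter_apply]
  rfl

lemma koszulProj_coe (k : ℕ) (z : koszulDeg ι R M k) : koszulProj ι R M k z = z :=
  LinearMap.congr_fun (Finsupp.restrictDom_comp_subtype {S : Finset ι | S.card = k}) z

lemma koszulProj_single_of_eq {k : ℕ} {S : Finset ι} (h : S.card = k) (a : M) :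
    (koszulProj ι R M k (Finsupp.single S a) : Finset ι →₀ M) = Finsupp.single S a := by
  ext T
  rw [koszulProj_apply, ite_eq_left_iff]
  intro hT
  rw [Finsupp.single_eq_of_ne]
  rintro rfl
  exact hT h

lemma koszulProj_single_of_ne {k : ℕ} {S : Finset ι} (h : S.card ≠ k) (a : M) :
    koszulProj ι R M k (Finsupp.single S a) = 0 := by
  ext T
  rw [koszulProj_apply, Submodule.coe_zero, Finsupp.zero_apply, ite_eq_right_iff]
  intro hT
  rw [Finsupp.single_eq_of_ne]
  rintro rfl
  exact h hT

lemma koszulDeg_mem_of_mapRange {ι R M N : Type*} [CommRing R] [AddCommGroup M]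
    [Module R M] [AddCommGroup N] [Module R N] (f : M →ₗ[R] N) {k : ℕ}
    {z : Finset ι →₀ M} (hz : z ∈ koszulDeg ι R M k) :
    Finsupp.mapRange.linearMap f z ∈ koszulDeg ι R N k :=
  fun _ hS => hz (Finsupp.support_mapRange (hf := map_zero f) hS)

/-- The functoriality of the part of degree `k` of the Koszul complex. -/
noncomputable def koszulDegMap (ι : Type*) {M N : Type*} [AddCommGroup M] [Module R M]
    [AddCommGroup N] [Module R N] (f : M →ₗ[R] N) (k : ℕ) :
    koszulDeg ι R M k →ₗ[R] koszulDeg ι R N k :=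
  (Finsupp.mapRange.linearMap f).restrict fun _ hz => koszulDeg_mem_of_mapRange f hz

lemma koszulDegMap_injective {N : Type*} [AddCommGroup N] [Module R N] {f : M →ₗ[R] N}
    (hf : Function.Injective f) (k : ℕ) : Function.Injective (koszulDegMap ι f k) :=
  fun _ _ h => Subtype.ext (Finsupp.mapRange_injective f (map_zero f) hf (congrArg Subtype.val h))

lemma koszulDegMap_surjective {N : Type*} [AddCommGroup N] [Module R N] {f : M →ₗ[R] N}
    (hf : Function.Surjective f) (k : ℕ) : Function.Surjective (koszulDegMap ι f k) := by
  intro z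
  obtain ⟨y, hy⟩ := Finsupp.mapRange_surjective f (map_zero f) hf z.1
  refine ⟨koszulProj ι R M k y, Subtype.ext (Finsupp.ext fun S => ?_)⟩
  have h1 := DFunLike.congr_fun hy S
  rw [← koszulProj_coe k z, koszulProj_apply, ← h1]
  change f ((koszulProj ι R M k y).1 S) = _
  rw [koszulProj_apply]
  split_ifs <;> simp

lemma koszulDegMap_exact {N Q : Type*} [AddCommGroup N] [Module R N] [AddCommGroup Q] [Module R Q]
    {f : M →ₗ[R] N} {g : N →ₗ[R] Q} (h : Function.Exact f g) (k : ℕ) :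
    Function.Exact (koszulDegMap ι f k) (koszulDegMap ι g k) := by
  have hgf (a : M) : g (f a) = 0 := (h _).2 ⟨a, rfl⟩
  intro z
  constructor
  · intro hz
    have hz' (S : Finset ι) : ∃ a, f a = z.1 S ∧ (z.1 S = 0 → a = 0) := by
      by_cases h0 : z.1 S = 0
      · exact ⟨0, by simp [h0]⟩
      · obtain ⟨a, ha⟩ := (h (z.1 S)).1 (DFunLike.congr_fun (congrArg Subtype.val hz) S)
        exact ⟨a, ha, fun h => absurd h h0⟩
    choose a ha ha0 using hz'
    refine ⟨⟨Finsupp.onFinset z.1.support a fun S hS => Finsupp.mem_support_iff.2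
      (mt (ha0 S) hS), fun S hS => z.2 (Finsupp.support_onFinset_subset hS)⟩, Subtype.ext
        (Finsupp.ext ha)⟩
  · rintro ⟨y, rfl⟩
    exact Subtype.ext (Finsupp.ext fun S => hgf _)

variable [LinearOrder ι] (x : ι → R)

lemma koszulD_koszulProj (k : ℕ) (z : Finset ι →₀ M) :
    koszulD x M (koszulProj ι R M (k + 1) z) = koszulProj ι R M k (koszulD x M z) := by
  induction z using Finsupp.induction_linear with
  | zero => simp
  | add f g hf hg => simp only [map_add, Submodule.coe_add, hf, hg]
  | single S a =>
    rw [koszulD_single, map_sum, Submodule.coe_sum]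
    by_cases h : S.card = k + 1
    · rw [koszulProj_single_of_eq h, koszulD_single]
      refine Finset.sum_congr rfl fun m hm => ?_
      rw [map_smul, Submodule.coe_smul, koszulProj_single_of_eq]
      rw [Finset.card_erase_of_mem hm, h, Nat.add_sub_cancel]
    · rw [koszulProj_single_of_ne h, Submodule.coe_zero, map_zero]
      refine (Finset.sum_eq_zero fun m hm => ?_).symm
      rw [map_smul, koszulProj_single_of_ne, smul_zero, Submodule.coe_zero]
      have := Finset.card_pos.2 ⟨m, hm⟩
      rw [Finset.card_erase_of_mem hm]
      omega

lemma koszulD_mem_koszulDeg {k : ℕ} {z : Finset ι →₀ M} (hz : z ∈ koszulDeg ι R M (k + 1)) :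
    koszulD x M z ∈ koszulDeg ι R M k := by
  have := koszulD_koszulProj x k z
  rw [koszulProj_coe (k + 1) ⟨z, hz⟩] at this
  exact this ▸ Subtype.prop _

lemma koszulD_eq_zero {z : Finset ι →₀ M} (hz : z ∈ koszulDeg ι R M 0) :
    koszulD x M z = 0 := by
  rw [← Finsupp.sum_single z, Finsupp.sum, map_sum]
  refine Finset.sum_eq_zero fun S hS => ?_
  rw [koszulD_single, Finset.card_eq_zero.1 (hz hS), Finset.sum_empty]

/-- The differential of the Koszul complex from degree `k` to degree `l`. -/
noncomputable def koszulDiff (M : Type*) [AddCommGroup M] [Module R M] (k l : ℕ) :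
    koszulDeg ι R M k →ₗ[R] koszulDeg ι R M l :=
  koszulProj ι R M l ∘ₗ koszulD x M ∘ₗ (koszulDeg ι R M k).subtype

lemma koszulDiff_coe (k : ℕ) (z : koszulDeg ι R M (k + 1)) :
    (koszulDiff x M (k + 1) k z : Finset ι →₀ M) = koszulD x M z :=
  congrArg Subtype.val (koszulProj_coe k ⟨_, koszulD_mem_koszulDeg x z.2⟩)

lemma koszulDiff_eq_zero {k l : ℕ} (h : l + 1 ≠ k) : koszulDiff x M k l = 0 := by
  refine LinearMap.ext fun z => ?_
  obtain _ | k := k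
  · simp only [koszulDiff, LinearMap.comp_apply, Submodule.subtype_apply, koszulD_eq_zero x z.2,
      map_zero, LinearMap.zero_apply]
  · have := koszulDiff_coe x k z
    ext S
    simp only [koszulDiff, LinearMap.comp_apply, Submodule.subtype_apply, LinearMap.zero_apply,
      Submodule.coe_zero, Finsupp.zero_apply]
    rw [koszulProj_apply]
    split_ifs with hS
    · by_contra h0
      have h1 := koszulD_mem_koszulDeg x z.2 (Finsupp.mem_support_iff.2 h0)
      simp only [Set.mem_ofPred_eq] at hS h1
      omega
    · rfl

lemma koszulDiff_koszulDiff (i j k : ℕ) (z : koszulDeg ι R M i) :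
    koszulDiff x M j k (koszulDiff x M i j z) = 0 := by
  by_cases hi : j + 1 = i
  · by_cases hj : k + 1 = j
    · subst hj hi
      ext1
      rw [koszulDiff_coe, koszulDiff_coe, koszulD_koszulD, Submodule.coe_zero]
    · rw [koszulDiff_eq_zero x hj, LinearMap.zero_apply]
  · rw [koszulDiff_eq_zero x hi, LinearMap.zero_apply, map_zero]

lemma mapRange_koszulD {N : Type*} [AddCommGroup N] [Module R N] (f : M →ₗ[R] N)
    (z : Finset ι →₀ M) :
    Finsupp.mapRange.linearMap f (koszulD x M z) =
      koszulD x N (Finsupp.mapRange.linearMap f z) := by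
  induction z using Finsupp.induction_linear with
  | zero => simp
  | add f g hf hg => simp only [map_add, hf, hg]
  | single S a => simp [koszulD_single]

lemma koszulDegMap_koszulDiff {N : Type*} [AddCommGroup N] [Module R N] (f : M →ₗ[R] N)
    (k l : ℕ) (z : koszulDeg ι R M k) :
    koszulDegMap ι f l (koszulDiff x M k l z) = koszulDiff x N k l (koszulDegMap ι f k z) := by
  by_cases h : l + 1 = k
  · subst h
    ext1
    rw [koszulDiff_coe]
    refine Eq.trans ?_ (mapRange_koszulD x f _)
    exact congrArg (Finsupp.mapRange.linearMap f) (koszulDiff_coe x l z)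
  · rw [koszulDiff_eq_zero x h, koszulDiff_eq_zero x h, LinearMap.zero_apply, LinearMap.zero_apply,
      map_zero]

end

variable [LinearOrder ι] (x : ι → R)

/-- The Koszul complex of the family `x`, as a functor of the coefficient module. -/
@[simps]
noncomputable def koszulFunctor : ModuleCat.{u} R ⥤ ChainComplex (ModuleCat.{u} R) ℕ where
  obj M :=
    { X := fun k => ModuleCat.of R (koszulDeg ι R M k)
      d := fun k l => ModuleCat.ofHom (koszulDiff x M k l)
      shape := fun k l h => by
        rw [koszulDiff_eq_zero x h]; rfl
      d_comp_d' := fun i j k _ _ => by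
        ext1
        exact LinearMap.ext fun z => koszulDiff_koszulDiff x i j k z }
  map f :=
    { f := fun k => ModuleCat.ofHom (koszulDegMap ι f.hom k)
      comm' := fun k l _ => by
        ext1
        exact LinearMap.ext fun z => (koszulDegMap_koszulDiff x f.hom k l z).symm }
  map_id M := by
    ext k : 2
    refine LinearMap.ext fun z => Subtype.ext ?_
    exact LinearMap.congr_fun Finsupp.mapRange.linearMap_id _
  map_comp f g := by
    ext k : 2
    refine LinearMap.ext fun z => Subtype.ext ?_
    exact LinearMap.congr_fun (Finsupp.mapRange.linearMap_comp g.hom f.hom) _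

instance : (koszulFunctor x).PreservesZeroMorphisms where
  map_zero M N := by
    ext k : 2
    refine LinearMap.ext fun z => Subtype.ext (Finsupp.ext fun S => ?_)
    rfl

lemma shortExact_map_koszulFunctor (S : ShortComplex (ModuleCat.{u} R)) (hS : S.ShortExact) :
    (S.map (koszulFunctor x)).ShortExact := by
  have hf := hS.moduleCat_injective_f
  have hg := hS.moduleCat_surjective_g
  have hfg := (ShortComplex.ShortExact.moduleCat_exact_iff_function_exact _).1 hS.exact
  refine HomologicalComplex.shortExact_of_degreewise_shortExact _ fun k => ?_
  refine ModuleCat.shortComplex_shortExact _ ?_ ?_ ?_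
  · exact koszulDegMap_exact hfg k
  · exact koszulDegMap_injective hf k
  · exact koszulDegMap_surjective hg k

/-- A homological form of regularity of a family: each `x m` is a nonzerodivisor modulo any
finite collection of the `x l` with `m < l`. -/
def IsKoszulRegular (R : Type*) [CommRing R] {ι : Type*} [LinearOrder ι] (x : ι → R) : Prop :=
  ∀ (A : Finset ι) (m : ι), (∀ l ∈ A, m < l) → ∀ a : R,
    x m * a ∈ Ideal.span (x '' A) → a ∈ Ideal.span (x '' A)

lemma mem_smul_top_of_projective {P : Type*} [AddCommGroup P] [Module R P] [Module.Projective R P]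
    {I : Ideal R} {r : R} (hr : ∀ a, r * a ∈ I → a ∈ I) {a : P}
    (ha : r • a ∈ I • (⊤ : Submodule R P)) : a ∈ I • (⊤ : Submodule R P) := by
  obtain ⟨s, hs⟩ := Module.Projective.out (R := R) (P := P)
  rw [← hs a, Finsupp.linearCombination_apply]
  refine sum_mem fun i _ => Submodule.smul_mem_smul (hr _ ?_) trivial
  have : I • (⊤ : Submodule R P) ≤ Submodule.comap (Finsupp.lapply i ∘ₗ s) I :=
    Submodule.smul_le.2 fun c hc b _ => by
      rw [Submodule.mem_comap, map_smul]
      exact I.mul_mem_right _ hc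
  simpa using this ha

lemma exists_koszulDiff_eq {M : Type*} [AddCommGroup M] [Module R M]
    (hx : ∀ (A : Finset ι) (m : ι), (∀ l ∈ A, m < l) → ∀ a : M,
      x m • a ∈ Ideal.span (x '' A) • (⊤ : Submodule R M) →
        a ∈ Ideal.span (x '' A) • (⊤ : Submodule R M)) (k : ℕ)
    (z : koszulDeg ι R M (k + 1)) (hz : koszulDiff x M (k + 1) k z = 0) :
    ∃ c, koszulDiff x M (k + 2) (k + 1) c = z := by
  obtain ⟨c, -, b, hc⟩ := exists_eq_koszulD_add x hx (z.1.support.sup id)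
    (show z.1 ∈ koszulSupp R M _ from fun S hS => Finset.le_sup (f := id) hS)
    (by rw [← koszulDiff_coe, hz, Submodule.coe_zero])
  refine ⟨koszulProj ι R M (k + 2) c, Subtype.ext ?_⟩
  rw [koszulDiff_coe, koszulD_koszulProj, ← koszulProj_coe (k + 1) z, hc, map_add,
    koszulProj_single_of_ne (by simp), add_zero]

lemma isZero_homology_koszulFunctor (hx : IsKoszulRegular R x) (P : ModuleCat.{u} R) [Projective P]
    (k : ℕ) : Limits.IsZero (((koszulFunctor x).obj P).homology (k + 1)) := by
  have : Module.Projective R P := (IsProjective.iff_projective P).2 inferInstance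
  rw [← HomologicalComplex.exactAt_iff_isZero_homology,
    HomologicalComplex.exactAt_iff' _ (k + 2) (k + 1) k (by simp) (by simp),
    ShortComplex.moduleCat_exact_iff]
  exact exists_koszulDiff_eq x
    (fun A m hm _ ha => mem_smul_top_of_projective (hx A m hm) ha) k

end KoszulComplex

section KoszulTor

universe u

variable {ι R : Type u} [CommRing R] [LinearOrder ι] (x : ι → R)

/-- The augmentation of the Koszul complex. -/
noncomputable def koszulAug (ι : Type u) (I : Ideal R) (M : Type u) [AddCommGroup M]
    [Module R M] : koszulDeg ι R M 0 →ₗ[R] TensorProduct R (R ⧸ I) M :=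
  TensorProduct.mk R (R ⧸ I) M 1 ∘ₗ Finsupp.lapply ∅ ∘ₗ (koszulDeg ι R M 0).subtype

lemma koszulAug_surjective (ι : Type u) (I : Ideal R) (M : Type u) [AddCommGroup M]
    [Module R M] : Function.Surjective (koszulAug ι I M) := by
  intro t
  obtain ⟨b, rfl⟩ := TensorProduct.mk_surjective R M (R ⧸ I) Ideal.Quotient.mk_surjective t
  exact ⟨⟨Finsupp.single ∅ b, Finsupp.single_mem_supported R b rfl⟩,
    congrArg (TensorProduct.mk R (R ⧸ I) M 1) Finsupp.single_eq_same⟩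

lemma one_tmul_eq_zero_iff {I : Ideal R} {M : Type*} [AddCommGroup M] [Module R M] (a : M) :
    (1 : R ⧸ I) ⊗ₜ[R] a = 0 ↔ a ∈ I • (⊤ : Submodule R M) := by
  rw [← (TensorProduct.quotTensorEquivQuotSMul M I).map_eq_zero_iff,
    ← map_one (Ideal.Quotient.mk I),
    TensorProduct.quotTensorEquivQuotSMul_mk_tmul, one_smul, Submodule.Quotient.mk_eq_zero]

lemma koszulAug_exact (M : Type u) [AddCommGroup M] [Module R M] {I : Ideal R}
    (hI : I = Ideal.span (Set.range x)) :
    Function.Exact (koszulDiff x M 1 0) (koszulAug ι I M) := by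
  intro z
  change (1 : R ⧸ I) ⊗ₜ[R] (z.1 ∅) = 0 ↔ _
  rw [one_tmul_eq_zero_iff]
  constructor
  · intro h
    rw [hI, ← Set.image_univ] at h
    obtain ⟨c, hc, hD⟩ := exists_koszulD_eq_single x Set.univ h
    refine ⟨⟨c, fun S hS => ?_⟩, Subtype.ext ?_⟩
    · obtain ⟨l, -, rfl⟩ := hc hS
      exact Finset.card_singleton l
    · rw [koszulDiff_coe, hD]
      ext S
      by_cases hS : S = ∅
      · simp [hS]
      · rw [Finsupp.single_eq_of_ne hS]
        by_contra h0
        exact hS (Finset.card_eq_zero.1 (z.2 (Finsupp.mem_support_iff.2 (Ne.symm h0))))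
  · rintro ⟨c, rfl⟩
    rw [koszulDiff_coe]
    exact koszulD_apply_empty_mem x fun S _ m _ => hI ▸ Ideal.subset_span ⟨m, rfl⟩

open MonoidalCategory

/-- The augmentation of the Koszul complex, as a morphism of modules. -/
noncomputable def koszulAugHom (I : Ideal R) (M : ModuleCat.{u} R) :
    ((koszulFunctor x).obj M).X 0 ⟶
      ((tensoringLeft (ModuleCat.{u} R)).obj (ModuleCat.of R (R ⧸ I))).obj M :=
  ModuleCat.ofHom (koszulAug ι I M)

lemma d_koszulAugHom {I : Ideal R} (hI : I = Ideal.span (Set.range x)) (M : ModuleCat.{u} R) :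
    ((koszulFunctor x).obj M).d 1 0 ≫ koszulAugHom x I M = 0 :=
  ModuleCat.hom_ext (LinearMap.ext (koszulAug_exact x M hI).apply_apply_eq_zero)

/-- The degree zero homology of the Koszul complex is the tensor product with the quotient by
the ideal generated by the family. -/
noncomputable def koszulHomologyZeroIso {I : Ideal R} (hI : I = Ideal.span (Set.range x)) :
    koszulFunctor x ⋙ HomologicalComplex.homologyFunctor (ModuleCat.{u} R) _ 0 ≅
      (tensoringLeft (ModuleCat.{u} R)).obj (ModuleCat.of R (R ⧸ I)) := by
  have h1 (M : ModuleCat.{u} R) : IsIso (((koszulFunctor x).obj M).descOpcycles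
      (koszulAugHom x I M) 1 (by simp) (d_koszulAugHom x hI M)) :=
    (ChainComplex.isIso_descOpcycles_iff _ _ _).2
      ⟨ModuleCat.shortComplex_exact _ (koszulAug_exact x M hI),
        (ModuleCat.epi_iff_surjective _).2 (koszulAug_surjective ι I M)⟩
  have h0 (M : ModuleCat.{u} R) : IsIso (((koszulFunctor x).obj M).homologyι 0) :=
    HomologicalComplex.isIso_homologyι _ 0 _ rfl (by simp)
  let φ (M : ModuleCat.{u} R) : ((koszulFunctor x).obj M).homology 0 ⟶
      ((tensoringLeft (ModuleCat.{u} R)).obj (ModuleCat.of R (R ⧸ I))).obj M :=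
    ((koszulFunctor x).obj M).homologyι 0 ≫ ((koszulFunctor x).obj M).descOpcycles
      (koszulAugHom x I M) 1 (by simp) (d_koszulAugHom x hI M)
  have hφ (M : ModuleCat.{u} R) : IsIso (φ M) := IsIso.comp_isIso
  have nat {M N : ModuleCat.{u} R} (f : M ⟶ N) :
      HomologicalComplex.homologyMap ((koszulFunctor x).map f) 0 ≫ φ N = φ M ≫
        ((tensoringLeft (ModuleCat.{u} R)).obj (ModuleCat.of R (R ⧸ I))).map f := by
    dsimp only [φ]
    rw [HomologicalComplex.homologyι_naturality_assoc,
      HomologicalComplex.opcyclesMap_comp_descOpcycles, Category.assoc,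
      HomologicalComplex.descOpcycles_comp]
    rfl
  exact NatIso.ofComponents (fun M => @asIso _ _ _ _ (φ M) (hφ M)) nat

/-- The `Tor` groups of the quotient by a Koszul regular family are computed by the Koszul
complex. -/
theorem nonempty_tor_iso_koszul (hx : IsKoszulRegular R x) {I : Ideal R}
    (hI : I = Ideal.span (Set.range x)) (M : ModuleCat.{u} R) (s : ℕ) :
    Nonempty (((Tor (ModuleCat.{u} R) s).obj (ModuleCat.of R (R ⧸ I))).obj M ≅
      ((koszulFunctor x).obj M).homology s) :=
  nonempty_leftDerived_iso_homology _ _ (shortExact_map_koszulFunctor x)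
    (isZero_homology_koszulFunctor x hx) (koszulHomologyZeroIso x hI) M s

end KoszulTor

section KoszulHomology

variable {ι : Type*} [LinearOrder ι] {R : Type*} [CommRing R] (x : ι → R)
  (M : Type*) [AddCommGroup M] [Module R M]

/-- The cycles of degree `k` of the Koszul complex. -/
noncomputable def koszulCycles (k : ℕ) : AddSubgroup (Finset ι →₀ M) :=
  (koszulDeg ι R M k ⊓ LinearMap.ker (koszulD x M)).toAddSubgroup

/-- The boundaries of degree `k` of the Koszul complex. -/
noncomputable def koszulBoundaries (k : ℕ) : AddSubgroup (Finset ι →₀ M) :=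
  ((koszulDeg ι R M (k + 1)).map (koszulD x M)).toAddSubgroup

/-- The homology of the Koszul complex, as an additive group. -/
abbrev KoszulHomology (k : ℕ) : Type _ :=
  koszulCycles x M k ⧸ (koszulBoundaries x M k).addSubgroupOf (koszulCycles x M k)

variable {M}

lemma mem_koszulCycles {k : ℕ} {z : Finset ι →₀ M} :
    z ∈ koszulCycles x M k ↔ (∀ S, z S ≠ 0 → S.card = k) ∧ koszulD x M z = 0 := by
  refine and_congr ?_ Iff.rfl
  exact ⟨fun h S hS => h (Finsupp.mem_support_iff.2 hS), fun h S hS =>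
    h S (Finsupp.mem_support_iff.1 hS)⟩

lemma mem_koszulBoundaries {k : ℕ} {z : Finset ι →₀ M} :
    z ∈ koszulBoundaries x M k ↔
      ∃ c : Finset ι →₀ M, (∀ S, c S ≠ 0 → S.card = k + 1) ∧ koszulD x M c = z := by
  refine exists_congr fun c => and_congr ?_ Iff.rfl
  exact ⟨fun h S hS => h (Finsupp.mem_support_iff.2 hS), fun h S hS =>
    h S (Finsupp.mem_support_iff.1 hS)⟩

end KoszulHomology

section

universe u

variable {ι R : Type u} [CommRing R] [LinearOrder ι] (x : ι → R)

lemma koszulDiff_pred_eq_zero_iff {M : Type*} [AddCommGroup M] [Module R M] (k : ℕ)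
    (z : koszulDeg ι R M k) : koszulDiff x M k (k - 1) z = 0 ↔ koszulD x M z = 0 := by
  obtain _ | k := k
  · simp [koszulDiff_eq_zero, koszulD_eq_zero x z.2]
  · rw [← koszulDiff_coe]
    exact Subtype.ext_iff

/-- The homology of the Koszul complex is given by cycles modulo boundaries. -/
theorem nonempty_homology_koszul_addEquiv (M : ModuleCat.{u} R) (s : ℕ) :
    Nonempty (((koszulFunctor x).obj M).homology s ≃+ KoszulHomology x M s) := by
  let K := (koszulFunctor x).obj M
  let S := K.sc' (s + 1) s (s - 1)
  have i : K.homology s ≅ S.moduleCatLeftHomologyData.H :=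
    K.homologyIsoSc' (s + 1) s (s - 1) (by simp) (by cases s <;> simp) ≪≫ S.moduleCatHomologyIso
  let f : koszulCycles x M s →+ S.moduleCatLeftHomologyData.H :=
    AddMonoidHom.comp (Submodule.mkQ _).toAddMonoidHom
      { toFun := fun z => (⟨⟨z.1, z.2.1⟩,
          (koszulDiff_pred_eq_zero_iff x s _).2 z.2.2⟩ : LinearMap.ker S.g.hom)
        map_zero' := rfl
        map_add' := fun _ _ => rfl }
  have hf : Function.Surjective f := by
    intro h
    obtain ⟨⟨z, hz⟩, rfl⟩ := Submodule.mkQ_surjective _ h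
    exact ⟨⟨z.1, z.2, (koszulDiff_pred_eq_zero_iff x s _).1 hz⟩, rfl⟩
  have hk : f.ker = (koszulBoundaries x M s).addSubgroupOf (koszulCycles x M s) := by
    ext z
    refine (Submodule.Quotient.mk_eq_zero _).trans ?_
    constructor
    · rintro ⟨c, hc⟩
      exact ⟨c.1, c.2, (koszulDiff_coe x s c).symm.trans (congrArg (fun y => y.1.1) hc)⟩
    · rintro ⟨c, hc, hcz⟩
      refine ⟨⟨c, hc⟩, Subtype.ext (Subtype.ext ?_)⟩
      exact (koszulDiff_coe x s ⟨c, hc⟩).trans hcz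
  exact ⟨i.toLinearEquiv.toAddEquiv.trans
    ((QuotientAddGroup.quotientKerEquivOfSurjective f hf).symm.trans
      (QuotientAddGroup.quotientAddEquivOfEq hk))⟩

end

section KoszulSplit

variable {α β ι : Type*} (e : α ⊕ β ≃ ι)

/-- The finset of `ι ≃ α ⊕ β` with components `U` and `T`. -/
def joinFinset (T : Finset β) (U : Finset α) : Finset ι :=
  (U.disjSum T).map e.toEmbedding

lemma joinFinset_inj {T T' : Finset β} {U U' : Finset α} :
    joinFinset e T U = joinFinset e T' U' ↔ T = T' ∧ U = U' := by
  rw [joinFinset, joinFinset, Finset.map_inj, Finset.disjSum_eq_iff, Finset.toLeft_disjSum,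
    Finset.toRight_disjSum, and_comm]

lemma exists_eq_joinFinset (S : Finset ι) : ∃ T U, S = joinFinset e T U := by
  refine ⟨(S.map e.symm.toEmbedding).toRight, (S.map e.symm.toEmbedding).toLeft, ?_⟩
  rw [joinFinset, Finset.toLeft_disjSum_toRight, Finset.map_map]
  simp

lemma card_joinFinset (T : Finset β) (U : Finset α) :
    (joinFinset e T U).card = U.card + T.card := by
  rw [joinFinset, Finset.card_map, Finset.card_disjSum]

lemma joinFinset_injective (T : Finset β) : Function.Injective (joinFinset e T) :=
  fun _ _ h => ((joinFinset_inj e).1 h).2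

variable {N : Type*} [AddCommGroup N]

/-- The inclusion of the summand indexed by `T`. -/
noncomputable def joinIncl (N : Type*) [AddCommGroup N] (T : Finset β) :
    (Finset α →₀ N) →+ (Finset ι →₀ N) :=
  Finsupp.mapDomain.addMonoidHom (joinFinset e T)

/-- The projection onto the summand indexed by `T`. -/
noncomputable def joinProj (N : Type*) [AddCommGroup N] (T : Finset β) :
    (Finset ι →₀ N) →+ (Finset α →₀ N) :=
  Finsupp.comapDomain.addMonoidHom (joinFinset_injective e T)

lemma joinProj_apply (T : Finset β) (z : Finset ι →₀ N) (U : Finset α) :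
    joinProj e N T z U = z (joinFinset e T U) :=
  rfl

lemma joinIncl_single (T : Finset β) (U : Finset α) (a : N) :
    joinIncl e N T (Finsupp.single U a) = Finsupp.single (joinFinset e T U) a :=
  Finsupp.mapDomain_single

lemma joinProj_joinIncl_self (T : Finset β) (y : Finset α →₀ N) :
    joinProj e N T (joinIncl e N T y) = y :=
  Finsupp.comapDomain_mapDomain _ (joinFinset_injective e T) y

lemma joinProj_joinIncl_of_ne {T T' : Finset β} (h : T ≠ T') (y : Finset α →₀ N) :
    joinProj e N T (joinIncl e N T' y) = 0 := by
  ext U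
  rw [joinProj_apply]
  refine Finsupp.mapDomain_of_notMem_range _ _ ?_
  rintro ⟨U', hU⟩
  exact h ((joinFinset_inj e).1 hU).1.symm

lemma joinIncl_joinProj_sum (z : Finset ι →₀ N) :
    ∃ F : Finset (Finset β), z = ∑ T ∈ F, joinIncl e N T (joinProj e N T z) := by
  classical
  refine ⟨z.support.image fun S => (S.map e.symm.toEmbedding).toRight, Finsupp.ext fun S => ?_⟩
  obtain ⟨T, U, rfl⟩ := exists_eq_joinFinset e S
  rw [← joinProj_apply, ← joinProj_apply, map_sum, Finset.sum_eq_single T, joinProj_joinIncl_self]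
  · exact fun T' _ hT => joinProj_joinIncl_of_ne e hT.symm _
  · intro hT
    rw [joinProj_joinIncl_self]
    ext U
    by_contra h
    refine hT (Finset.mem_image.2 ⟨joinFinset e T U, Finsupp.mem_support_iff.2 h, ?_⟩)
    ext b
    simp [joinFinset]

lemma card_eq_of_joinIncl_ne_zero {T : Finset β} {k : ℕ} {y : Finset α →₀ N}
    (hy : ∀ U, y U ≠ 0 → U.card = k) (S : Finset ι) (hS : joinIncl e N T y S ≠ 0) :
    S.card = k + T.card := by
  obtain ⟨T', U, rfl⟩ := exists_eq_joinFinset e S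
  rw [← joinProj_apply] at hS
  by_cases hT : T' = T
  · rw [hT, joinProj_joinIncl_self] at hS
    rw [card_joinFinset, hy U hS, hT]
  · rw [joinProj_joinIncl_of_ne e hT] at hS
    exact absurd rfl hS

lemma card_eq_of_joinProj_ne_zero {T : Finset β} {k : ℕ} {z : Finset ι →₀ N}
    (hz : ∀ S, z S ≠ 0 → S.card = k + T.card) (U : Finset α) (hU : joinProj e N T z U ≠ 0) :
    U.card = k := by
  have := hz _ hU
  rw [card_joinFinset] at this
  omega

variable [LinearOrder α] [LinearOrder ι]

lemma erase_joinFinset (T : Finset β) (U : Finset α) (a : α) :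
    (joinFinset e T U).erase (e (.inl a)) = joinFinset e T (U.erase a) := by
  ext i
  obtain ⟨i | i, rfl⟩ := e.surjective i <;> simp [joinFinset]

variable (h₁ : ∀ a a', e (.inl a) < e (.inl a') ↔ a < a')
  (h₂ : ∀ a b, e (.inl a) < e (.inr b))

include h₁ h₂ in
lemma card_filter_joinFinset (T : Finset β) (U : Finset α) (a : α) :
    ((joinFinset e T U).filter (· < e (.inl a))).card = (U.filter (· < a)).card := by
  have : (joinFinset e T U).filter (· < e (.inl a)) = joinFinset e ∅ (U.filter (· < a)) := by
    ext i
    obtain ⟨i | i, rfl⟩ := e.surjective i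
    · simp [joinFinset, h₁]
    · simp [joinFinset, (h₂ a i).le]
  rw [this, card_joinFinset, Finset.card_empty, add_zero]

variable {R₀ R : Type*} [CommRing R₀] [CommRing R] [Module R₀ N] [Module R N]

variable {x₀ : α → R₀} {x : ι → R} (hx₁ : ∀ a (y : N), x (e (.inl a)) • y = x₀ a • y)
  (hx₂ : ∀ b (y : N), x (e (.inr b)) • y = 0)

include h₁ h₂ hx₁ hx₂

lemma joinIncl_koszulD (T : Finset β) (y : Finset α →₀ N) :
    koszulD x N (joinIncl e N T y) = joinIncl e N T (koszulD x₀ N y) := by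
  induction y using Finsupp.induction_linear with
  | zero => simp
  | add f g hf hg => simp only [map_add, hf, hg]
  | single U y =>
    rw [joinIncl_single, koszulD_single, koszulD_single, map_sum]
    simp only [Finsupp.smul_single, joinIncl_single]
    rw [joinFinset, Finset.sum_map, Finset.sum_disjSum, ← joinFinset,
      add_eq_left.2 (Finset.sum_eq_zero fun b _ => ?_)]
    · refine Finset.sum_congr rfl fun a _ => ?_
      change Finsupp.single ((joinFinset e T U).erase (e (.inl a)))
        ((koszulSign R (e (.inl a)) (joinFinset e T U) * x (e (.inl a))) • y) = _
      rw [erase_joinFinset, koszulSign, card_filter_joinFinset e h₁ h₂, koszulSign, mul_smul,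
        mul_smul, hx₁]
      congr 1
      rcases Nat.even_or_odd (U.filter (· < a)).card with h | h <;> simp [h.neg_one_pow]
    · change Finsupp.single _ ((koszulSign R _ _ * x (e (.inr b))) • y) = _
      rw [mul_smul, hx₂, smul_zero, Finsupp.single_zero]

lemma joinProj_koszulD (T : Finset β) (z : Finset ι →₀ N) :
    joinProj e N T (koszulD x N z) = koszulD x₀ N (joinProj e N T z) := by
  induction z using Finsupp.induction_linear with
  | zero => simp
  | add f g hf hg => simp only [map_add, hf, hg]
  | single S y =>
    obtain ⟨T', U, rfl⟩ := exists_eq_joinFinset e S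
    rw [← joinIncl_single, joinIncl_koszulD e h₁ h₂ hx₁ hx₂]
    by_cases hT : T = T'
    · rw [hT, joinProj_joinIncl_self, joinProj_joinIncl_self]
    · rw [joinProj_joinIncl_of_ne e hT, joinProj_joinIncl_of_ne e hT, map_zero]

lemma joinIncl_mem_koszulCycles {T : Finset β} {k : ℕ} {y : Finset α →₀ N}
    (hy : y ∈ koszulCycles x₀ N k) : joinIncl e N T y ∈ koszulCycles x N (k + T.card) := by
  rw [mem_koszulCycles] at hy ⊢
  refine ⟨card_eq_of_joinIncl_ne_zero e hy.1, ?_⟩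
  rw [joinIncl_koszulD e h₁ h₂ hx₁ hx₂, hy.2, map_zero]

lemma joinIncl_mem_koszulBoundaries {T : Finset β} {k : ℕ} {y : Finset α →₀ N}
    (hy : y ∈ koszulBoundaries x₀ N k) : joinIncl e N T y ∈ koszulBoundaries x N (k + T.card) := by
  rw [mem_koszulBoundaries] at hy ⊢
  obtain ⟨c, hc, rfl⟩ := hy
  refine ⟨joinIncl e N T c, fun S hS => ?_, joinIncl_koszulD e h₁ h₂ hx₁ hx₂ T c⟩
  rw [card_eq_of_joinIncl_ne_zero e hc S hS]
  omega

lemma joinProj_mem_koszulCycles {T : Finset β} {k : ℕ} {z : Finset ι →₀ N}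
    (hz : z ∈ koszulCycles x N (k + T.card)) : joinProj e N T z ∈ koszulCycles x₀ N k := by
  rw [mem_koszulCycles] at hz ⊢
  refine ⟨card_eq_of_joinProj_ne_zero e hz.1, ?_⟩
  rw [← joinProj_koszulD e h₁ h₂ hx₁ hx₂, hz.2, map_zero]

lemma joinProj_mem_koszulBoundaries {T : Finset β} {k : ℕ} {z : Finset ι →₀ N}
    (hz : z ∈ koszulBoundaries x N (k + T.card)) : joinProj e N T z ∈ koszulBoundaries x₀ N k := by
  rw [mem_koszulBoundaries] at hz ⊢
  obtain ⟨c, hc, rfl⟩ := hz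
  refine ⟨joinProj e N T c, card_eq_of_joinProj_ne_zero e fun S hS => ?_,
    (joinProj_koszulD e h₁ h₂ hx₁ hx₂ T c).symm⟩
  rw [hc S hS]
  omega

/-- If the part of a family `x` indexed by `β` acts as zero on `N`, then the Koszul homology
splits as a direct sum indexed by the finite subsets of `β`. -/
theorem nonempty_koszulHomology_addEquiv (s : ℕ) :
    Nonempty (KoszulHomology x N s ≃+ DirectSum (Fin (s + 1)) fun j =>
      Set.powersetCard β j.1 →₀ KoszulHomology x₀ N (s - j.1)) := by
  have hT (j : Fin (s + 1)) (T : Set.powersetCard β j.1) : s - j.1 + T.1.card = s := by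
    have := T.2
    have := j.2
    rw [show T.1.card = j.1 from T.2]
    omega
  let incl (j : Fin (s + 1)) (T : Set.powersetCard β j.1) :
      KoszulHomology x₀ N (s - j.1) →+ KoszulHomology x N s :=
    QuotientAddGroup.map _ _ (((joinIncl e N T.1).comp (koszulCycles x₀ N _).subtype).codRestrict
      (koszulCycles x N s) fun y => by
        have := joinIncl_mem_koszulCycles e h₁ h₂ hx₁ hx₂ (T := T.1) y.2
        rwa [hT j T] at this)
      fun y hy => by
        have := joinIncl_mem_koszulBoundaries e h₁ h₂ hx₁ hx₂ (T := T.1) hy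
        rwa [hT j T] at this
  let proj (j : Fin (s + 1)) (T : Set.powersetCard β j.1) :
      KoszulHomology x N s →+ KoszulHomology x₀ N (s - j.1) :=
    QuotientAddGroup.map _ _ (((joinProj e N T.1).comp (koszulCycles x N s).subtype).codRestrict
      (koszulCycles x₀ N _) fun y =>
        joinProj_mem_koszulCycles e h₁ h₂ hx₁ hx₂ (T := T.1) (by rw [hT j T]; exact y.2))
      fun y hy => joinProj_mem_koszulBoundaries e h₁ h₂ hx₁ hx₂ (T := T.1)
        (by rw [hT j T]; exact hy)
  have proj_incl_self (j) (T : Set.powersetCard β j.1) (y) : proj j T (incl j T y) = y := by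
    induction y using QuotientAddGroup.induction_on with
    | H y => exact congrArg QuotientAddGroup.mk (Subtype.ext (joinProj_joinIncl_self e T.1 y.1))
  have proj_incl_of_ne (j) (T : Set.powersetCard β j.1) (j') (T' : Set.powersetCard β j'.1)
      (h : T.1 ≠ T'.1) (y) : proj j T (incl j' T' y) = 0 := by
    induction y using QuotientAddGroup.induction_on with
    | H y =>
      exact congrArg (QuotientAddGroup.mk' _) (Subtype.ext (joinProj_joinIncl_of_ne e h y.1) :
        _ = (0 : koszulCycles x₀ N (s - j.1)))
  let θ : (DirectSum (Fin (s + 1)) fun j =>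
      Set.powersetCard β j.1 →₀ KoszulHomology x₀ N (s - j.1)) →+ KoszulHomology x N s :=
    DirectSum.toAddMonoid fun j => Finsupp.liftAddHom (incl j)
  have θ_of (j) (T) (y) : θ (DirectSum.of _ j (Finsupp.single T y)) = incl j T y := by
    simp [θ]
  have proj_θ (u) (j) (T : Set.powersetCard β j.1) : proj j T (θ u) = u j T := by
    induction u using DirectSum.induction_on with
    | zero => simp
    | add u v hu hv => rw [map_add, map_add, hu, hv]; rfl
    | of j' f =>
      induction f using Finsupp.induction_linear with
      | zero => simp
      | add f g hf hg => simp only [map_add, hf, hg]; rfl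
      | single T' y =>
        rw [θ_of]
        by_cases hj : j' = j
        · subst hj
          rw [DirectSum.of_eq_same]
          by_cases hTT : T' = T
          · rw [hTT, proj_incl_self, Finsupp.single_eq_same]
          · rw [Finsupp.single_eq_of_ne (Ne.symm hTT), proj_incl_of_ne]
            exact fun h => hTT (Subtype.ext h.symm)
        · rw [DirectSum.of_eq_of_ne _ _ _ (Ne.symm hj), proj_incl_of_ne, Finsupp.zero_apply]
          intro h
          apply hj
          have h1 : T.1.card = j.1 := T.2
          have h2 : T'.1.card = j'.1 := T'.2
          rw [Fin.ext_iff, ← h1, ← h2, h]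
  have θ_inj : Function.Injective θ := by
    rw [injective_iff_map_eq_zero]
    intro u hu
    ext j T
    rw [← proj_θ, hu, map_zero]
    rfl
  have θ_surj : Function.Surjective θ := by
    intro h
    obtain ⟨z, rfl⟩ := QuotientAddGroup.mk_surjective h
    let P : AddSubgroup (Finset ι →₀ N) :=
      (θ.range.comap (QuotientAddGroup.mk' _)).map (koszulCycles x N s).subtype
    suffices hz : z.1 ∈ P by
      obtain ⟨z', hz', h⟩ := hz
      rwa [Subtype.ext h] at hz'
    obtain ⟨F, hF⟩ := joinIncl_joinProj_sum e z.1
    rw [hF]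
    refine sum_mem fun T _ => ?_
    have hz := ((mem_koszulCycles x).1 z.2).1
    by_cases hTs : T.card ≤ s
    · let j : Fin (s + 1) := ⟨T.card, by omega⟩
      let T' : Set.powersetCard β j.1 := ⟨T, rfl⟩
      have hy : joinProj e N T z.1 ∈ koszulCycles x₀ N (s - j.1) :=
        joinProj_mem_koszulCycles e h₁ h₂ hx₁ hx₂ (by rw [hT j T']; exact z.2)
      have hy' := joinIncl_mem_koszulCycles e h₁ h₂ hx₁ hx₂ (T := T) hy
      rw [hT j T'] at hy'
      exact ⟨⟨_, hy'⟩, ⟨_, θ_of j T' (QuotientAddGroup.mk ⟨_, hy⟩)⟩, rfl⟩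
    · have : joinProj e N T z.1 = 0 := by
        ext U
        by_contra h
        have := hz _ h
        rw [card_joinFinset] at this
        omega
      rw [this, map_zero]
      exact zero_mem P
  exact ⟨(AddEquiv.ofBijective θ ⟨θ_inj, θ_surj⟩).symm⟩

end KoszulSplit

section KoszulPolynomial

variable {A σ : Type*} [CommRing A]

/-- The family consisting of a constant `c` followed by the variables of a polynomial ring. -/
noncomputable def constOrX (c : A) : WithBot σ → MvPolynomial σ A :=
  WithBot.recBotCoe (MvPolynomial.C c) MvPolynomial.X

lemma constOrX_bot (c : A) : constOrX c (⊥ : WithBot σ) = MvPolynomial.C c :=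
  rfl

lemma constOrX_coe (c : A) (i : σ) : constOrX c (i : WithBot σ) = MvPolynomial.X i :=
  rfl

lemma range_constOrX (c : A) :
    Set.range (constOrX (σ := σ) c) = {MvPolynomial.C c} ∪ Set.range MvPolynomial.X := by
  ext y
  simp [WithBot.exists, constOrX_bot, constOrX_coe, eq_comm]

theorem isKoszulRegular_constOrX {ι : Type*} [LinearOrder ι] {c : A}
    (hc : c ∈ nonZeroDivisors A) {v : ι → WithBot σ} (hv : Function.Injective v)
    (hbot : ∀ m, v m = ⊥ → ∀ l, m ≤ l) :
    IsKoszulRegular (MvPolynomial σ A) (constOrX c ∘ v) := by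
  intro F m hF a ha
  have hspan : (constOrX (A := A) c ∘ v) '' F = MvPolynomial.X '' {i : σ | ∃ l ∈ F, v l = i} := by
    ext y
    constructor
    · rintro ⟨l, hl, rfl⟩
      cases h : v l with
      | bot => exact absurd (hbot l h m) (hF l hl).not_ge
      | coe i => exact ⟨i, ⟨l, hl, h⟩, by rw [Function.comp_apply, h, constOrX_coe]⟩
    · rintro ⟨i, ⟨l, hl, h⟩, rfl⟩
      exact ⟨l, hl, by rw [Function.comp_apply, h, constOrX_coe]⟩
  rw [hspan, MvPolynomial.mem_ideal_span_X_image] at ha ⊢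
  intro d hd
  rw [MvPolynomial.mem_support_iff] at hd
  cases h : v m with
  | bot =>
    refine ha d ?_
    rw [MvPolynomial.mem_support_iff, Function.comp_apply, h, constOrX_bot,
      MvPolynomial.coeff_C_mul]
    exact fun h0 => hd (hc.1 _ h0)
  | coe i =>
    obtain ⟨i', ⟨l, hl, hi'⟩, hd'⟩ := ha (Finsupp.single i 1 + d) (by
      rwa [MvPolynomial.mem_support_iff, Function.comp_apply, h, constOrX_coe,
        MvPolynomial.coeff_X_mul])
    refine ⟨i', ⟨l, hl, hi'⟩, ?_⟩
    have hne : i ≠ i' := by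
      rintro rfl
      exact (hF l hl).ne (hv (h.trans hi'.symm))
    simpa [Finsupp.single_apply, hne] using hd'

end KoszulPolynomial

section PolynomialTor

variable (p n : ℕ)

/-- The generators `p, v_1, v_2, …` listed as `p, v_1, …, v_n` followed by `v_{n+1}, v_{n+2}, …`,
where `⊥` is the index of `p` and `k` that of `v_{k+1}`. -/
def splitIndex (i : WithBot (Fin n) ⊕ₗ ℕ) : WithBot ℕ :=
  Sum.elim (WithBot.map Fin.val) (fun j => WithBot.some (n + j)) (ofLex i)

lemma splitIndex_inl (a : WithBot (Fin n)) :
    splitIndex n (toLex (.inl a)) = WithBot.map Fin.val a :=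
  rfl

lemma splitIndex_inr (j : ℕ) : splitIndex n (toLex (.inr j)) = WithBot.some (n + j) :=
  rfl

lemma splitIndex_bijective : Function.Bijective (splitIndex n) := by
  constructor
  · intro i i' h
    obtain ⟨i | i, rfl⟩ := toLex.surjective i <;> obtain ⟨i' | i', rfl⟩ := toLex.surjective i'
    · rw [splitIndex_inl, splitIndex_inl] at h
      rw [WithBot.map_injective Fin.val_injective h]
    · rw [splitIndex_inl, splitIndex_inr] at h
      cases i with
      | bot => exact absurd h.symm WithBot.coe_ne_bot
      | coe i => have := WithBot.coe_inj.1 h; omega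
    · rw [splitIndex_inl, splitIndex_inr] at h
      cases i' with
      | bot => exact absurd h WithBot.coe_ne_bot
      | coe i' => have := WithBot.coe_inj.1 h; omega
    · rw [splitIndex_inr, splitIndex_inr] at h
      rw [Nat.add_left_cancel (WithBot.coe_inj.1 h)]
  · intro k
    cases k with
    | bot => exact ⟨toLex (.inl ⊥), rfl⟩
    | coe k =>
      by_cases h : k < n
      · exact ⟨toLex (.inl ((⟨k, h⟩ : Fin n) : WithBot (Fin n))), rfl⟩
      · exact ⟨toLex (.inr (k - n)), by rw [splitIndex_inr, Nat.add_sub_cancel' (not_lt.1 h)]⟩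

lemma le_of_splitIndex_eq_bot {i : WithBot (Fin n) ⊕ₗ ℕ} (h : splitIndex n i = ⊥)
    (l : WithBot (Fin n) ⊕ₗ ℕ) : i ≤ l := by
  rw [(splitIndex_bijective n).1 (h.trans (splitIndex_inl n ⊥).symm), Sum.Lex.inl_bot]
  exact bot_le

variable [hP : (Ideal.span {(p : ℤ)}).IsPrime]

lemma natCast_mem_nonZeroDivisors_Zp [Fact p.Prime] : (p : Zp p) ∈ nonZeroDivisors (Zp p) := by
  have := IsLocalization.map_nonZeroDivisors_le (Ideal.span {(p : ℤ)}).primeCompl (Zp p)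
  refine this ⟨(p : ℤ), mem_nonZeroDivisors_of_ne_zero ?_, by simp⟩
  exact_mod_cast (Fact.out : p.Prime).ne_zero

lemma mBn_eq_span_range :
    mBn p n = Ideal.span (Set.range (constOrX (σ := Fin n) (p : Zp p) ∘ id)) := by
  rw [Function.comp_id, range_constOrX, map_natCast, mBn]

lemma mB_eq_span_range :
    mB p = Ideal.span (Set.range (constOrX (p : Zp p) ∘ splitIndex n)) := by
  rw [(splitIndex_bijective n).2.range_comp, range_constOrX, map_natCast, mB]

lemma nonempty_torBn_addEquiv [Fact p.Prime] (N : ModuleCat (Bn p n)) (k : ℕ) :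
    Nonempty (TorBn p n k N ≃+
      KoszulHomology (constOrX (σ := Fin n) (p : Zp p) ∘ id) N k) := by
  obtain ⟨f⟩ := nonempty_tor_iso_koszul _ (isKoszulRegular_constOrX
    (natCast_mem_nonZeroDivisors_Zp p) (v := id) Function.injective_id
    fun m hm l => by rw [show m = ⊥ from hm]; exact bot_le) (mBn_eq_span_range p n) N k
  obtain ⟨g⟩ := nonempty_homology_koszul_addEquiv
    (constOrX (σ := Fin n) (p : Zp p) ∘ id) N k
  exact ⟨f.toLinearEquiv.toAddEquiv.trans g⟩

lemma nonempty_torB_addEquiv [Fact p.Prime] (M : ModuleCat (B p)) (k : ℕ) :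
    Nonempty (((Tor (ModuleCat (B p)) k).obj (FpB p)).obj M ≃+
      KoszulHomology (constOrX (p : Zp p) ∘ splitIndex n) M k) := by
  obtain ⟨f⟩ := nonempty_tor_iso_koszul _ (isKoszulRegular_constOrX
    (natCast_mem_nonZeroDivisors_Zp p) (splitIndex_bijective n).1
    fun m hm l => le_of_splitIndex_eq_bot n hm l) (mB_eq_span_range p n) M k
  obtain ⟨g⟩ := nonempty_homology_koszul_addEquiv (constOrX (p : Zp p) ∘ splitIndex n) M k
  exact ⟨f.toLinearEquiv.toAddEquiv.trans g⟩

lemma qB_constOrX_inl (a : WithBot (Fin n)) :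
    qB p n (constOrX (p : Zp p) (splitIndex n (toLex (.inl a)))) = constOrX (p : Zp p) a := by
  cases a with
  | bot => exact (qB p n).commutes _
  | coe i =>
    rw [splitIndex_inl, WithBot.map_coe, constOrX_coe, constOrX_coe, qB, MvPolynomial.aeval_X,
      dif_pos i.2]

lemma qB_constOrX_inr (j : ℕ) :
    qB p n (constOrX (p : Zp p) (splitIndex n (toLex (.inr j)))) = 0 := by
  rw [splitIndex_inr, constOrX_coe, qB, MvPolynomial.aeval_X, dif_neg (by omega)]

/-- Tensoring with an exterior power of a free module gives finitely supported functions. -/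
lemma nonempty_tensor_exteriorPower_addEquiv (K M κ : Type*) [CommRing K] [AddCommGroup M]
    [Module K M] [LinearOrder κ] (j : ℕ) :
    Nonempty (TensorProduct K M (⋀[K]^j (κ →₀ K)) ≃+ (Set.powersetCard κ j →₀ M)) :=
  ⟨(TensorProduct.equivFinsuppOfBasisRight
    ((Finsupp.basisSingleOne (R := K) (ι := κ)).exteriorPower j)).toAddEquiv⟩

end PolynomialTor

/-- Let `N` be a `B_n`-module, regarded as a `B`-module via `q`.  Then for every `s ≥ 0` there
is an isomorphism of `𝔽_p`-vector spaces
`Tor_s^B(𝔽_p, N) ≅ ⊕_{j=0}^{s} Tor_{s−j}^{B_n}(𝔽_p, N) ⊗_{𝔽_p} Λ^j(V)`,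
where `V` is an `𝔽_p`-vector space with countable basis (indexed by `v_{n+1}, v_{n+2}, …`).
Each `Tor_{s−j}^{B_n}(𝔽_p, N)` is an `𝔽_p`-vector space; its (necessarily unique) `ZMod p`-module
structure is supplied as an instance argument, and the isomorphism of `𝔽_p`-vector spaces is
recorded as an additive isomorphism (which is automatically `𝔽_p`-linear). -/
theorem stmt15 (p n : ℕ) [Fact p.Prime] [hP : (Ideal.span {(p : ℤ)}).IsPrime]
    (s : ℕ) (N : ModuleCat (Bn p n))
    [inst : ∀ j : Fin (s + 1), Module (ZMod p) (TorBn p n (s - j.1) N)] :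
    Nonempty
      ((((Tor (ModuleCat (B p)) s).obj (FpB p)).obj
          ((ModuleCat.restrictScalars (qB p n).toRingHom).obj N)) ≃+
        DirectSum (Fin (s + 1)) (fun j =>
          TensorProduct (ZMod p) (TorBn p n (s - j.1) N)
            (⋀[ZMod p]^(j.1) (ℕ →₀ ZMod p)))) := by
  obtain ⟨f⟩ := nonempty_torB_addEquiv p n
    ((ModuleCat.restrictScalars (qB p n).toRingHom).obj N) s
  obtain ⟨g⟩ := nonempty_koszulHomology_addEquiv
    (N := (ModuleCat.restrictScalars (qB p n).toRingHom).obj N)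
    (x₀ := constOrX (σ := Fin n) (p : Zp p) ∘ id)
    (x := constOrX (p : Zp p) ∘ splitIndex n) toLex
    (fun _ _ => Sum.Lex.inl_lt_inl_iff) Sum.Lex.inl_lt_inr
    (fun a (y : N) => congrArg (· • y) (qB_constOrX_inl p n a))
    (fun b (y : N) => (congrArg (· • y) (qB_constOrX_inr p n b)).trans (zero_smul _ y)) s
  have h (j : Fin (s + 1)) : Nonempty ((Set.powersetCard ℕ j.1 →₀
      KoszulHomology (constOrX (σ := Fin n) (p : Zp p) ∘ id) N (s - j.1)) ≃+
      TensorProduct (ZMod p) (TorBn p n (s - j.1) N) (⋀[ZMod p]^(j.1) (ℕ →₀ ZMod p))) := by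
    obtain ⟨a⟩ := nonempty_torBn_addEquiv p n N (s - j.1)
    obtain ⟨b⟩ := nonempty_tensor_exteriorPower_addEquiv (ZMod p) (TorBn p n (s - j.1) N) ℕ j.1
    exact ⟨(Finsupp.mapRange.addEquiv a.symm).trans b.symm⟩
  exact ⟨(f.trans g).trans (DFinsupp.mapRange.addEquiv fun j => (h j).some)⟩
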